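/- Let P(a,b,c,z) = z⁴ − 6z² + (−2cos a − 2cos b − 2cos c − 2cos(a+b+c))·z + (3 − 2cos(a+b) − 2cos(b+c) − 2cos(a+c)). At each of the four points (π/2,π/2,π/2,√3), (π/2,π/2,π/2,−√3), (3π/2,3π/2,3π/2,√3), (3π/2,3π/2,3π/2,−√3), the Hessian matrix of P (in the variables a,b,c,z, in this order) equals the matrix [[−4,−2,−2,0],[−2,−4,−2,0],[−2,−2,−4,0],[0,0,0,24]], and this matrix has eigenvalues −8, −2, −2, 24; in particular it is nondegenerate with signature (−,−,−,+), so these critical points of P are Dirac points. -/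

import Mathlib

open Real Polynomial Matrix

/-- The characteristic polynomial of the Gyroid Harper Hamiltonian, as a
smooth real function of `(a, b, c, z)`. -/
noncomputable def P (a b c z : ℝ) : ℝ :=
  z ^ 4 - 6 * z ^ 2
    + (-2 * Real.cos a - 2 * Real.cos b - 2 * Real.cos c - 2 * Real.cos (a + b + c)) * z
    + (3 - 2 * Real.cos (a + b) - 2 * Real.cos (b + c) - 2 * Real.cos (a + c))

/-- Partial derivative in the first variable. -/
noncomputable def pda (f : ℝ → ℝ → ℝ → ℝ → ℝ) (a b c z : ℝ) : ℝ :=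
  deriv (fun t => f t b c z) a

/-- Partial derivative in the second variable. -/
noncomputable def pdb (f : ℝ → ℝ → ℝ → ℝ → ℝ) (a b c z : ℝ) : ℝ :=
  deriv (fun t => f a t c z) b

/-- Partial derivative in the third variable. -/
noncomputable def pdc (f : ℝ → ℝ → ℝ → ℝ → ℝ) (a b c z : ℝ) : ℝ :=
  deriv (fun t => f a b t z) c

/-- Partial derivative in the fourth variable. -/
noncomputable def pdz (f : ℝ → ℝ → ℝ → ℝ → ℝ) (a b c z : ℝ) : ℝ :=
  deriv (fun t => f a b c t) z

/-- The Hessian matrix of `P` in the variables `(a, b, c, z)`, in this order. -/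
noncomputable def hessP (a b c z : ℝ) : Matrix (Fin 4) (Fin 4) ℝ :=
  !![pda (pda P) a b c z, pdb (pda P) a b c z, pdc (pda P) a b c z, pdz (pda P) a b c z;
     pda (pdb P) a b c z, pdb (pdb P) a b c z, pdc (pdb P) a b c z, pdz (pdb P) a b c z;
     pda (pdc P) a b c z, pdb (pdc P) a b c z, pdc (pdc P) a b c z, pdz (pdc P) a b c z;
     pda (pdz P) a b c z, pdb (pdz P) a b c z, pdc (pdz P) a b c z, pdz (pdz P) a b c z]

/-- The explicit Hessian at the Dirac points of the Gyroid. -/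
def diracHess : Matrix (Fin 4) (Fin 4) ℝ :=
  !![-4, -2, -2, 0;
     -2, -4, -2, 0;
     -2, -2, -4, 0;
      0,  0,  0, 24]

theorem pda_P : pda P = fun a b c z =>
    2 * (Real.sin a + Real.sin (a + b + c)) * z + 2 * Real.sin (a + b) + 2 * Real.sin (a + c) := by
  funext a b c z
  simp (disch := fun_prop) [pda, P]
  ring

theorem pdb_P : pdb P = fun a b c z =>
    2 * (Real.sin b + Real.sin (a + b + c)) * z + 2 * Real.sin (a + b) + 2 * Real.sin (b + c) := by
  funext a b c z
  simp (disch := fun_prop) [pdb, P]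
  ring

theorem pdc_P : pdc P = fun a b c z =>
    2 * (Real.sin c + Real.sin (a + b + c)) * z + 2 * Real.sin (b + c) + 2 * Real.sin (a + c) := by
  funext a b c z
  simp (disch := fun_prop) [pdc, P]
  ring

theorem pdz_P : pdz P = fun a b c z =>
    4 * z ^ 3 - 12 * z
      - 2 * (Real.cos a + Real.cos b + Real.cos c + Real.cos (a + b + c)) := by
  funext a b c z
  simp (disch := fun_prop) [pdz, P]
  ring

set_option maxHeartbeats 1000000 in
/-- On the diagonal `a = b = c`, the Hessian is `diracHess` whenever `cos a = 0` and `z ^ 2 = 3`. -/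
theorem hessP_eq_diracHess {a z : ℝ} (ha : Real.cos a = 0) (hz : z ^ 2 = 3) :
    hessP a a a z = diracHess := by
  have hs : Real.sin a ^ 2 = 1 := by rw [Real.sin_sq, ha]; norm_num
  have hs2 : Real.sin a * Real.sin a = 1 := by rw [← sq, hs]
  rw [hessP, diracHess, pda_P, pdb_P, pdc_P, pdz_P]
  ext i j
  fin_cases i <;> fin_cases j <;>
    simp (disch := fun_prop) [pda, pdb, pdc, pdz] <;>
    try simp [Real.cos_add, Real.sin_add, ha, hs2]
  all_goals linarith

theorem diracHess_charpoly : diracHess.charpoly = (X + 8) * (X + 2) ^ 2 * (X - 24) := by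
  have h24 : (C 24 : ℝ[X]) = 24 := rfl
  have h4 : (C 4 : ℝ[X]) = 4 := rfl
  have h2 : (C 2 : ℝ[X]) = 2 := rfl
  simp [Matrix.charpoly, Matrix.charmatrix, diracHess, Matrix.det_succ_row_zero,
    Fin.sum_univ_succ, Fin.succAbove, h24, h4, h2]
  ring

theorem diracHess_det_ne_zero : diracHess.det ≠ 0 := by
  simp [diracHess, Matrix.det_succ_row_zero, Fin.sum_univ_succ, Fin.succAbove]
  norm_num

theorem gyroid_dirac_hessian :
    (∀ p : ℝ × ℝ × ℝ × ℝ,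
        p ∈ ({(π / 2, π / 2, π / 2, Real.sqrt 3), (π / 2, π / 2, π / 2, -Real.sqrt 3),
              (3 * π / 2, 3 * π / 2, 3 * π / 2, Real.sqrt 3),
              (3 * π / 2, 3 * π / 2, 3 * π / 2, -Real.sqrt 3)} : Set (ℝ × ℝ × ℝ × ℝ)) →
        hessP p.1 p.2.1 p.2.2.1 p.2.2.2 = diracHess) ∧
    diracHess.charpoly = (X + 8) * (X + 2) ^ 2 * (X - 24) ∧
    diracHess.det ≠ 0 := by
  have hsq : Real.sqrt 3 ^ 2 = 3 := Real.sq_sqrt (by norm_num)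
  have hc : Real.cos (3 * π / 2) = 0 := Real.cos_eq_zero_iff.mpr ⟨1, by push_cast; ring⟩
  refine ⟨?_, diracHess_charpoly, diracHess_det_ne_zero⟩
  rintro p (rfl | rfl | rfl | rfl)
  · exact hessP_eq_diracHess Real.cos_pi_div_two hsq
  · exact hessP_eq_diracHess Real.cos_pi_div_two (by rw [neg_sq, hsq])
  · exact hessP_eq_diracHess hc hsq
  · exact hessP_eq_diracHess hc (by rw [neg_sq, hsq])
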